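/- Let u(s) = a·cn(s,k) on [0, 2K(k)] with k = 0.71 and a² = π/(K(k)² − (1/k²)(K(k)² − E(k)K(k))). Then the quantity LHS := (∫₀^{L} u²)·(−∫₀^{L}(u')² + (1/2)∫₀^{L} u⁴) − 2L·∫₀^{L}(u'' + (1/2)u³)² with L = 2K(k) is strictly positive, while L·∫₀^{L} u² ds = 4π. -/

import Mathlib

open Real MeasureTheory intervalIntegral

/-- Incomplete elliptic integral of the first kind `F(φ,k)`. -/
noncomputable def ellF (k φ : ℝ) : ℝ :=
  ∫ ψ in (0:ℝ)..φ, (Real.sqrt (1 - k ^ 2 * Real.sin ψ ^ 2))⁻¹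

/-- Complete elliptic integral of the first kind `K(k)`. -/
noncomputable def ellK (k : ℝ) : ℝ := ellF k (Real.pi / 2)

/-- Complete elliptic integral of the second kind `E(k)`. -/
noncomputable def ellE (k : ℝ) : ℝ :=
  ∫ ψ in (0:ℝ)..(Real.pi / 2), Real.sqrt (1 - k ^ 2 * Real.sin ψ ^ 2)

/-- Jacobi amplitude `AM(s,k)`, the inverse of `φ ↦ F(φ,k)`. -/
noncomputable def am (k s : ℝ) : ℝ := Function.invFun (ellF k) s

/-- Jacobi elliptic sine `sn(s,k)`. -/
noncomputable def sn (k s : ℝ) : ℝ := Real.sin (am k s)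

/-- Jacobi elliptic cosine `cn(s,k)`. -/
noncomputable def cn (k s : ℝ) : ℝ := Real.cos (am k s)


noncomputable def elD (k φ : ℝ) : ℝ := Real.sqrt (1 - k ^ 2 * Real.sin φ ^ 2)

noncomputable def elEi (k φ : ℝ) : ℝ := ∫ ψ in (0:ℝ)..φ, elD k ψ

section analysis
variable {k : ℝ}

lemma elD_arg_pos (hk : k ^ 2 < 1) (φ : ℝ) : 0 < 1 - k ^ 2 * Real.sin φ ^ 2 := by
  nlinarith [Real.sin_sq_add_cos_sq φ, sq_nonneg (Real.cos φ), sq_nonneg (Real.sin φ), sq_nonneg k]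

lemma elD_pos (hk : k ^ 2 < 1) (φ : ℝ) : 0 < elD k φ := Real.sqrt_pos.2 (elD_arg_pos hk φ)

lemma elD_le_one (φ : ℝ) : elD k φ ≤ 1 := by
  unfold elD
  rw [Real.sqrt_le_one]
  nlinarith [mul_nonneg (sq_nonneg k) (sq_nonneg (Real.sin φ))]

lemma elD_sq (hk : k ^ 2 < 1) (φ : ℝ) : elD k φ ^ 2 = 1 - k ^ 2 * Real.sin φ ^ 2 :=
  Real.sq_sqrt (elD_arg_pos hk φ).le

lemma elD_cont : Continuous (elD k) := by unfold elD; fun_prop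

lemma elD_inv_cont (hk : k ^ 2 < 1) : Continuous (fun φ => (elD k φ)⁻¹) :=
  elD_cont.inv₀ (fun φ => (elD_pos hk φ).ne')

lemma ellF_hasDeriv (hk : k ^ 2 < 1) (φ : ℝ) : HasDerivAt (ellF k) ((elD k φ)⁻¹) φ := by
  have h := elD_inv_cont hk
  exact intervalIntegral.integral_hasDerivAt_right (h.intervalIntegrable _ _)
    (h.stronglyMeasurableAtFilter _ _) h.continuousAt

lemma elEi_hasDeriv (φ : ℝ) : HasDerivAt (elEi k) (elD k φ) φ := by
  have h := elD_cont (k := k)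
  exact intervalIntegral.integral_hasDerivAt_right (h.intervalIntegrable _ _)
    (h.stronglyMeasurableAtFilter _ _) h.continuousAt

lemma ellF_strictMono (hk : k ^ 2 < 1) : StrictMono (ellF k) := by
  apply strictMono_of_deriv_pos
  intro x
  rw [(ellF_hasDeriv hk x).deriv]
  exact inv_pos.2 (elD_pos hk x)

lemma ellF_cont (hk : k ^ 2 < 1) : Continuous (ellF k) :=
  continuous_iff_continuousAt.2 fun x => (ellF_hasDeriv hk x).continuousAt

lemma ellF_zero : ellF k 0 = 0 := by simp [ellF]

lemma ellF_sub_mono (hk : k ^ 2 < 1) : Monotone (fun φ => ellF k φ - φ) := by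
  have hd : ∀ x, HasDerivAt (fun φ => ellF k φ - φ) ((elD k x)⁻¹ - 1) x := fun x =>
    (ellF_hasDeriv hk x).sub (hasDerivAt_id x)
  apply monotone_of_deriv_nonneg
  · exact fun x => (hd x).differentiableAt
  · intro x
    rw [(hd x).deriv]
    have := (one_le_inv₀ (elD_pos hk x)).2 (elD_le_one x)
    linarith

lemma ellF_surj (hk : k ^ 2 < 1) : Function.Surjective (ellF k) := by
  apply (ellF_cont hk).surjective
  · apply Filter.tendsto_atTop_mono' _ _ Filter.tendsto_id
    filter_upwards [Filter.eventually_ge_atTop 0] with x hx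
    have := ellF_sub_mono hk hx
    simp only [ellF_zero] at this
    simp only [id]; linarith
  · apply Filter.tendsto_atBot_mono' _ _ Filter.tendsto_id
    filter_upwards [Filter.eventually_le_atBot 0] with x hx
    have := ellF_sub_mono hk hx
    simp only [ellF_zero] at this
    simp only [id]; linarith

lemma am_ellF (hk : k ^ 2 < 1) (φ : ℝ) : am k (ellF k φ) = φ :=
  Function.leftInverse_invFun (ellF_strictMono hk).injective φ

lemma ellF_am (hk : k ^ 2 < 1) (s : ℝ) : ellF k (am k s) = s :=
  Function.rightInverse_invFun (ellF_surj hk) s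

lemma am_mono (hk : k ^ 2 < 1) : Monotone (am k) := by
  intro s t hst
  rw [← (ellF_strictMono hk).le_iff_le, ellF_am hk, ellF_am hk]; exact hst

lemma am_cont (hk : k ^ 2 < 1) : Continuous (am k) :=
  (am_mono hk).continuous_of_surjective (fun φ => ⟨_, am_ellF hk φ⟩)

lemma am_hasDeriv (hk : k ^ 2 < 1) (s : ℝ) : HasDerivAt (am k) (elD k (am k s)) s := by
  have h := HasDerivAt.of_local_left_inverse (f := ellF k) (g := am k) (a := s)
    (f' := (elD k (am k s))⁻¹) (am_cont hk).continuousAt (ellF_hasDeriv hk _)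
    (inv_ne_zero (elD_pos hk _).ne') (Filter.Eventually.of_forall (ellF_am hk))
  simpa using h

lemma half_sym (f : ℝ → ℝ) (hf : Continuous f) (hs : ∀ x, f (π - x) = f x) :
    ∫ x in (0:ℝ)..π, f x = 2 * ∫ x in (0:ℝ)..(π/2), f x := by
  rw [← intervalIntegral.integral_add_adjacent_intervals (b := π/2)
    (hf.intervalIntegrable _ _) (hf.intervalIntegrable _ _)]
  have := intervalIntegral.integral_comp_sub_left (a := 0) (b := π/2) f π
  simp only [hs] at this
  rw [this]
  have h2 : π - π/2 = π/2 := by ring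
  rw [h2, sub_zero]; ring

lemma elD_sym (x : ℝ) : elD k (π - x) = elD k x := by simp [elD]

lemma ellF_pi (hk : k ^ 2 < 1) : ellF k π = 2 * ellK k :=
  half_sym _ (elD_inv_cont hk) (fun x => by simp)

lemma elEi_pi : elEi k π = 2 * ellE k :=
  half_sym _ elD_cont elD_sym

lemma am_zero (hk : k ^ 2 < 1) : am k 0 = 0 := by
  have := am_ellF hk 0
  rwa [ellF_zero] at this

lemma am_twoK (hk : k ^ 2 < 1) : am k (2 * ellK k) = π := by
  rw [← ellF_pi hk, am_ellF hk]

lemma cn_hasDeriv (hk : k ^ 2 < 1) (s : ℝ) :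
    HasDerivAt (cn k) (-(sn k s * elD k (am k s))) s := by
  have := (am_hasDeriv hk s).cos
  refine this.congr_deriv ?_
  simp [sn]

lemma sn_hasDeriv (hk : k ^ 2 < 1) (s : ℝ) :
    HasDerivAt (sn k) (cn k s * elD k (am k s)) s := (am_hasDeriv hk s).sin

lemma dn_hasDeriv (hk : k ^ 2 < 1) (s : ℝ) :
    HasDerivAt (fun s => elD k (am k s)) (-(k ^ 2 * sn k s * cn k s)) s := by
  have h1 := (((sn_hasDeriv hk s).pow 2).const_mul (k ^ 2)).const_sub 1
  have h2 := h1.sqrt (elD_arg_pos hk (am k s)).ne'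
  refine h2.congr_deriv ?_
  have hp := elD_pos hk (am k s)
  change -(k ^ 2 * _) / (2 * elD k (am k s)) = _
  field_simp
  simp
  ring

lemma cn_cont (hk : k ^ 2 < 1) : Continuous (cn k) :=
  continuous_iff_continuousAt.2 fun x => (cn_hasDeriv hk x).continuousAt

lemma sn_sq (s : ℝ) : sn k s ^ 2 = 1 - cn k s ^ 2 := by
  unfold sn cn; rw [Real.sin_sq]

lemma dn_sq (hk : k ^ 2 < 1) (s : ℝ) :
    elD k (am k s) ^ 2 = 1 - k ^ 2 + k ^ 2 * cn k s ^ 2 := by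
  have := sn_sq (k := k) s
  rw [elD_sq hk]; unfold sn at this; rw [this]; ring

lemma I2 (hk : k ^ 2 < 1) : (1 - k ^ 2) * (2 * ellK k) + 
    k ^ 2 * ∫ s in (0:ℝ)..(2 * ellK k), cn k s ^ 2 = 2 * ellE k := by
  have hc := cn_cont hk
  have hd : ∀ s ∈ Set.uIcc 0 (2 * ellK k), HasDerivAt (fun s => elEi k (am k s))
      ((1 - k ^ 2) + k ^ 2 * cn k s ^ 2) s := by
    intro s _
    refine ((elEi_hasDeriv (k := k) (am k s)).comp s (am_hasDeriv hk s)).congr_deriv ?_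
    rw [← dn_sq hk]; ring
  have h := intervalIntegral.integral_eq_sub_of_hasDerivAt hd
    (Continuous.intervalIntegrable (by fun_prop) _ _)
  rw [intervalIntegral.integral_add (by simp)
    (Continuous.intervalIntegrable (by fun_prop) _ _), intervalIntegral.integral_const_mul] at h
  simp only [am_twoK hk, am_zero hk, elEi_pi] at h
  simp [elEi] at h
  linarith

lemma I4 (hk : k ^ 2 < 1) : 3 * k ^ 2 * (∫ s in (0:ℝ)..(2 * ellK k), cn k s ^ 4)
    + (2 - 4 * k ^ 2) * (∫ s in (0:ℝ)..(2 * ellK k), cn k s ^ 2)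
    - (1 - k ^ 2) * (2 * ellK k) = 0 := by
  have hc := cn_cont hk
  have hd : ∀ s ∈ Set.uIcc 0 (2 * ellK k), HasDerivAt
      (fun s => sn k s * cn k s * elD k (am k s))
      (3 * k ^ 2 * cn k s ^ 4 + (2 - 4 * k ^ 2) * cn k s ^ 2 - (1 - k ^ 2)) s := by
    intro s _
    refine (((sn_hasDeriv hk s).mul (cn_hasDeriv hk s)).mul (dn_hasDeriv hk s)).congr_deriv ?_
    have h1 := sn_sq (k := k) s
    have h2 := dn_sq hk s
    simp only [Pi.mul_apply]
    generalize sn k s = S at *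
    generalize cn k s = C at *
    generalize elD k (am k s) = D at *
    linear_combination (C ^ 2 - S ^ 2) * h2 + (- (k ^ 2) * C ^ 2 - (1 - k ^ 2 + k ^ 2 * C ^ 2)) * h1
  have h := intervalIntegral.integral_eq_sub_of_hasDerivAt hd
    (Continuous.intervalIntegrable (by fun_prop) _ _)
  rw [intervalIntegral.integral_sub (Continuous.intervalIntegrable (by fun_prop) _ _) (by simp),
    intervalIntegral.integral_add 
    (Continuous.intervalIntegrable (by fun_prop) _ _)
    (Continuous.intervalIntegrable (by fun_prop) _ _), intervalIntegral.integral_const_mul,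
    intervalIntegral.integral_const_mul] at h
  simp [am_twoK hk, am_zero hk, sn] at h
  linarith

lemma I6 (hk : k ^ 2 < 1) : 5 * k ^ 2 * (∫ s in (0:ℝ)..(2 * ellK k), cn k s ^ 6)
    + (4 - 8 * k ^ 2) * (∫ s in (0:ℝ)..(2 * ellK k), cn k s ^ 4)
    - 3 * (1 - k ^ 2) * (∫ s in (0:ℝ)..(2 * ellK k), cn k s ^ 2) = 0 := by
  have hc := cn_cont hk
  have hd : ∀ s ∈ Set.uIcc 0 (2 * ellK k), HasDerivAt
      (fun s => sn k s * cn k s ^ 3 * elD k (am k s))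
      (5 * k ^ 2 * cn k s ^ 6 + (4 - 8 * k ^ 2) * cn k s ^ 4 
        - 3 * (1 - k ^ 2) * cn k s ^ 2) s := by
    intro s _
    refine (((sn_hasDeriv hk s).mul ((cn_hasDeriv hk s).pow 3)).mul 
      (dn_hasDeriv hk s)).congr_deriv ?_
    have h1 := sn_sq (k := k) s
    have h2 := dn_sq hk s
    simp only [Pi.mul_apply, Pi.pow_apply]
    generalize sn k s = S at *
    generalize cn k s = C at *
    generalize elD k (am k s) = D at *
    push_cast
    linear_combination (C ^ 4 - 3 * S ^ 2 * C ^ 2) * h2 + 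
      (- (k ^ 2) * C ^ 4 - 3 * C ^ 2 * (1 - k ^ 2 + k ^ 2 * C ^ 2)) * h1
  have h := intervalIntegral.integral_eq_sub_of_hasDerivAt hd
    (Continuous.intervalIntegrable (by fun_prop) _ _)
  rw [intervalIntegral.integral_sub (Continuous.intervalIntegrable (by fun_prop) _ _) 
    (Continuous.intervalIntegrable (by fun_prop) _ _),
    intervalIntegral.integral_add 
    (Continuous.intervalIntegrable (by fun_prop) _ _)
    (Continuous.intervalIntegrable (by fun_prop) _ _), intervalIntegral.integral_const_mul,
    intervalIntegral.integral_const_mul, intervalIntegral.integral_const_mul] at h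
  simp [am_twoK hk, am_zero hk, sn] at h
  linarith

lemma deriv_u (hk : k ^ 2 < 1) (a : ℝ) : deriv (fun s => a * cn k s) =
    fun s => a * (-(sn k s * elD k (am k s))) := by
  ext s
  exact ((cn_hasDeriv hk s).const_mul a).deriv

lemma deriv2_u (hk : k ^ 2 < 1) (a : ℝ) : deriv (deriv (fun s => a * cn k s)) =
    fun s => a * ((2 * k ^ 2 - 1) * cn k s - 2 * k ^ 2 * cn k s ^ 3) := by
  rw [deriv_u hk]
  ext s
  refine ((((sn_hasDeriv hk s).mul (dn_hasDeriv hk s)).neg).const_mul a).deriv.trans ?_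
  have h1 := sn_sq (k := k) s
  have h2 := dn_sq hk s
  generalize sn k s = S at *
  generalize cn k s = C at *
  generalize elD k (am k s) = D at *
  linear_combination (-a * C) * h2 + a * k ^ 2 * C * h1

lemma int_du (hk : k ^ 2 < 1) (a : ℝ) :
    ∫ s in (0:ℝ)..(2 * ellK k), (deriv (fun s => a * cn k s) s) ^ 2 =
    a ^ 2 * ((1 - k ^ 2) * (2 * ellK k) 
      + (2 * k ^ 2 - 1) * (∫ s in (0:ℝ)..(2 * ellK k), cn k s ^ 2)
      - k ^ 2 * (∫ s in (0:ℝ)..(2 * ellK k), cn k s ^ 4)) := by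
  have hc := cn_cont hk
  rw [deriv_u hk]
  have : ∀ s, (a * (-(sn k s * elD k (am k s)))) ^ 2 = 
    a ^ 2 * ((1 - k ^ 2) + (2 * k ^ 2 - 1) * cn k s ^ 2 - k ^ 2 * cn k s ^ 4) := by
    intro s
    have h1 := sn_sq (k := k) s
    have h2 := dn_sq hk s
    calc _ = a ^ 2 * (sn k s ^ 2 * elD k (am k s) ^ 2) := by ring
      _ = _ := by rw [h1, h2]; ring
  simp only [this]
  rw [intervalIntegral.integral_const_mul, 
    intervalIntegral.integral_sub (Continuous.intervalIntegrable (by fun_prop) _ _) 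
    (Continuous.intervalIntegrable (by fun_prop) _ _),
    intervalIntegral.integral_add (by simp)
    (Continuous.intervalIntegrable (by fun_prop) _ _), intervalIntegral.integral_const_mul,
    intervalIntegral.integral_const_mul]
  simp; left; ring

lemma int_d2u (hk : k ^ 2 < 1) (a : ℝ) :
    ∫ s in (0:ℝ)..(2 * ellK k), (deriv (deriv (fun s => a * cn k s)) s 
      + (1/2) * (a * cn k s) ^ 3) ^ 2 =
    a ^ 2 * ((2 * k ^ 2 - 1) ^ 2 * (∫ s in (0:ℝ)..(2 * ellK k), cn k s ^ 2)
      + 2 * (2 * k ^ 2 - 1) * (a ^ 2 / 2 - 2 * k ^ 2) * 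
        (∫ s in (0:ℝ)..(2 * ellK k), cn k s ^ 4)
      + (a ^ 2 / 2 - 2 * k ^ 2) ^ 2 * (∫ s in (0:ℝ)..(2 * ellK k), cn k s ^ 6)) := by
  have hc := cn_cont hk
  rw [deriv2_u hk]
  have : ∀ s, (a * ((2 * k ^ 2 - 1) * cn k s - 2 * k ^ 2 * cn k s ^ 3) 
      + (1/2) * (a * cn k s) ^ 3) ^ 2 = 
    a ^ 2 * ((2 * k ^ 2 - 1) ^ 2 * cn k s ^ 2 
      + 2 * (2 * k ^ 2 - 1) * (a ^ 2 / 2 - 2 * k ^ 2) * cn k s ^ 4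
      + (a ^ 2 / 2 - 2 * k ^ 2) ^ 2 * cn k s ^ 6) := by
    intro s; ring
  simp only [this]
  rw [intervalIntegral.integral_const_mul, 
    intervalIntegral.integral_add (Continuous.intervalIntegrable (by fun_prop) _ _) 
    (Continuous.intervalIntegrable (by fun_prop) _ _),
    intervalIntegral.integral_add (Continuous.intervalIntegrable (by fun_prop) _ _)
    (Continuous.intervalIntegrable (by fun_prop) _ _), intervalIntegral.integral_const_mul,
    intervalIntegral.integral_const_mul, intervalIntegral.integral_const_mul]

lemma int_u2 (a : ℝ) : ∫ s in (0:ℝ)..(2 * ellK k), (a * cn k s) ^ 2 =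
    a ^ 2 * ∫ s in (0:ℝ)..(2 * ellK k), cn k s ^ 2 := by
  simp only [mul_pow, intervalIntegral.integral_const_mul]

lemma int_u4 (a : ℝ) : ∫ s in (0:ℝ)..(2 * ellK k), (a * cn k s) ^ 4 =
    a ^ 4 * ∫ s in (0:ℝ)..(2 * ellK k), cn k s ^ 4 := by
  simp only [mul_pow, intervalIntegral.integral_const_mul]

end analysis

lemma pow_abs_bd (y : ℝ) (hy : |y| ≤ 34/100) (n : ℕ) :
    -(34/100 : ℝ) ^ n ≤ y ^ n ∧ y ^ n ≤ (34/100 : ℝ) ^ n := by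
  rw [← abs_le, abs_pow]
  exact pow_le_pow_left₀ (abs_nonneg y) hy n

lemma Pa (y : ℝ) (hy : |y| ≤ 34/100) : 0 ≤ 1 - ((1) * y ^ 0 + (-1/2) * y ^ 1 + (3/8) * y ^ 2 + (-5/16) * y ^ 3 + (35/128) * y ^ 4 + (-63/256) * y ^ 5 + (231/1024) * y ^ 6 + (-429/2048) * y ^ 7 + (6435/32768) * y ^ 8 + (-12155/65536) * y ^ 9 + (0) * y ^ 10) ^ 2 * (1 + y) := by
  have hb := pow_abs_bd y hy
  have h0 : 0 ≤ (46189/131072) * y ^ 0 + (-20995/131072) * y ^ 1 + (230945/2097152) * y ^ 2 + (-88825/1048576) * y ^ 3 + (1154725/16777216) * y ^ 4 + (-969969/16777216) * y ^ 5 + (53348295/1073741824) * y ^ 6 + (-5827965/134217728) * y ^ 7 + (165125675/4294967296) * y ^ 8 + (-147744025/4294967296) * y ^ 9 + (0) * y ^ 10 + (0) * y ^ 11 := by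
    have h1 := hb 1
    have h2 := hb 2
    have h3 := hb 3
    have h4 := hb 4
    have h5 := hb 5
    have h6 := hb 6
    have h7 := hb 7
    have h8 := hb 8
    have h9 := hb 9
    have h10 := hb 10
    have h11 := hb 11
    norm_num at h1 h2 h3 h4 h5 h6 h7 h8 h9 h10 h11 ⊢
    linarith [h1.1, h1.2, h2.1, h2.2, h3.1, h3.2, h4.1, h4.2, h5.1, h5.2, h6.1, h6.2, h7.1, h7.2, h8.1, h8.2, h9.1, h9.2, h10.1, h10.2, h11.1, h11.2]
  have h10 : 0 ≤ y ^ 10 := by positivity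
  have := mul_nonneg h10 h0
  refine this.trans_eq ?_
  ring

lemma Pb (y : ℝ) (hy : |y| ≤ 34/100) : 0 ≤ -(1 - ((1) * y ^ 0 + (-1/2) * y ^ 1 + (3/8) * y ^ 2 + (-5/16) * y ^ 3 + (35/128) * y ^ 4 + (-63/256) * y ^ 5 + (231/1024) * y ^ 6 + (-429/2048) * y ^ 7 + (6435/32768) * y ^ 8 + (-12155/65536) * y ^ 9 + (1/2) * y ^ 10) ^ 2 * (1 + y)) := by
  have hb := pow_abs_bd y hy
  have h0 : 0 ≤ (84883/131072) * y ^ 0 + (86531/131072) * y ^ 1 + (-493089/2097152) * y ^ 2 + (154361/1048576) * y ^ 3 + (-1810085/16777216) * y ^ 4 + (1428721/16777216) * y ^ 5 + (-75368391/1073741824) * y ^ 6 + (7990653/134217728) * y ^ 7 + (-221355563/4294967296) * y ^ 8 + (194602265/4294967296) * y ^ 9 + (4229/65536) * y ^ 10 + (1/4) * y ^ 11 := by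
    have h1 := hb 1
    have h2 := hb 2
    have h3 := hb 3
    have h4 := hb 4
    have h5 := hb 5
    have h6 := hb 6
    have h7 := hb 7
    have h8 := hb 8
    have h9 := hb 9
    have h10 := hb 10
    have h11 := hb 11
    norm_num at h1 h2 h3 h4 h5 h6 h7 h8 h9 h10 h11 ⊢
    linarith [h1.1, h1.2, h2.1, h2.2, h3.1, h3.2, h4.1, h4.2, h5.1, h5.2, h6.1, h6.2, h7.1, h7.2, h8.1, h8.2, h9.1, h9.2, h10.1, h10.2, h11.1, h11.2]
  have h10 : 0 ≤ y ^ 10 := by positivity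
  have := mul_nonneg h10 h0
  refine this.trans_eq ?_
  ring

lemma Qa (y : ℝ) (hy : |y| ≤ 34/100) : 0 ≤ -(1 + y - ((1) * y ^ 0 + (1/2) * y ^ 1 + (-1/8) * y ^ 2 + (1/16) * y ^ 3 + (-5/128) * y ^ 4 + (7/256) * y ^ 5 + (-21/1024) * y ^ 6 + (33/2048) * y ^ 7 + (-429/32768) * y ^ 8 + (715/65536) * y ^ 9 + (0) * y ^ 10) ^ 2) := by
  have hb := pow_abs_bd y hy
  have h0 : 0 ≤ (2431/131072) * y ^ 0 + (-221/32768) * y ^ 1 + (7735/2097152) * y ^ 2 + (-4675/2097152) * y ^ 3 + (23375/16777216) * y ^ 4 + (-7293/8388608) * y ^ 5 + (561561/1073741824) * y ^ 6 + (-306735/1073741824) * y ^ 7 + (511225/4294967296) * y ^ 8 + (0) * y ^ 9 + (0) * y ^ 10 := by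
    have h1 := hb 1
    have h2 := hb 2
    have h3 := hb 3
    have h4 := hb 4
    have h5 := hb 5
    have h6 := hb 6
    have h7 := hb 7
    have h8 := hb 8
    have h9 := hb 9
    have h10 := hb 10
    have h11 := hb 11
    norm_num at h1 h2 h3 h4 h5 h6 h7 h8 h9 h10 h11 ⊢
    linarith [h1.1, h1.2, h2.1, h2.2, h3.1, h3.2, h4.1, h4.2, h5.1, h5.2, h6.1, h6.2, h7.1, h7.2, h8.1, h8.2, h9.1, h9.2, h10.1, h10.2, h11.1, h11.2]
  have h10 : 0 ≤ y ^ 10 := by positivity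
  have := mul_nonneg h10 h0
  refine this.trans_eq ?_
  ring

lemma Qb (y : ℝ) (hy : |y| ≤ 34/100) : 0 ≤ 1 + y - ((1) * y ^ 0 + (1/2) * y ^ 1 + (-1/8) * y ^ 2 + (1/16) * y ^ 3 + (-5/128) * y ^ 4 + (7/256) * y ^ 5 + (-21/1024) * y ^ 6 + (33/2048) * y ^ 7 + (-429/32768) * y ^ 8 + (715/65536) * y ^ 9 + (-1/50) * y ^ 10) ^ 2 := by
  have hb := pow_abs_bd y hy
  have h0 : 0 ≤ (70297/3276800) * y ^ 0 + (21909/819200) * y ^ 1 + (-455519/52428800) * y ^ 2 + (247947/52428800) * y ^ 3 + (-247947/83886080) * y ^ 4 + (411701/209715200) * y ^ 5 + (-36059121/26843545600) * y ^ 6 + (24969879/26843545600) * y ^ 7 + (-69010513/107374182400) * y ^ 8 + (143/327680) * y ^ 9 + (-1/2500) * y ^ 10 := by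
    have h1 := hb 1
    have h2 := hb 2
    have h3 := hb 3
    have h4 := hb 4
    have h5 := hb 5
    have h6 := hb 6
    have h7 := hb 7
    have h8 := hb 8
    have h9 := hb 9
    have h10 := hb 10
    have h11 := hb 11
    norm_num at h1 h2 h3 h4 h5 h6 h7 h8 h9 h10 h11 ⊢
    linarith [h1.1, h1.2, h2.1, h2.2, h3.1, h3.2, h4.1, h4.2, h5.1, h5.2, h6.1, h6.2, h7.1, h7.2, h8.1, h8.2, h9.1, h9.2, h10.1, h10.2, h11.1, h11.2]
  have h10 : 0 ≤ y ^ 10 := by positivity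
  have := mul_nonneg h10 h0
  refine this.trans_eq ?_
  ring

lemma one_add_pos' (y : ℝ) (hy : |y| ≤ 34/100) : 0 < 1 + y := by
  have := (abs_le.1 hy).1
  linarith

lemma inv_sqrt_lo (y : ℝ) (hy : |y| ≤ 34/100) : (1) * y ^ 0 + (-1/2) * y ^ 1 + (3/8) * y ^ 2 + (-5/16) * y ^ 3 + (35/128) * y ^ 4 + (-63/256) * y ^ 5 + (231/1024) * y ^ 6 + (-429/2048) * y ^ 7 + (6435/32768) * y ^ 8 + (-12155/65536) * y ^ 9 + (0) * y ^ 10 ≤ (Real.sqrt (1 + y))⁻¹ := by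
  have h := Pa y hy
  have h0 := one_add_pos' y hy
  have hx := Real.sqrt_pos.2 h0
  have hx2 := Real.sq_sqrt h0.le
  rw [← one_div, le_div_iff₀ hx]
  refine le_of_abs_le (abs_le_of_sq_le_sq ?_ zero_le_one)
  rw [mul_pow, hx2]
  linarith

lemma inv_sqrt_hi (y : ℝ) (hy : |y| ≤ 34/100) : (Real.sqrt (1 + y))⁻¹ ≤ (1) * y ^ 0 + (-1/2) * y ^ 1 + (3/8) * y ^ 2 + (-5/16) * y ^ 3 + (35/128) * y ^ 4 + (-63/256) * y ^ 5 + (231/1024) * y ^ 6 + (-429/2048) * y ^ 7 + (6435/32768) * y ^ 8 + (-12155/65536) * y ^ 9 + (1/2) * y ^ 10 := by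
  have h := Pb y hy
  have hb := pow_abs_bd y hy
  have hp : 0 ≤ (1) * y ^ 0 + (-1/2) * y ^ 1 + (3/8) * y ^ 2 + (-5/16) * y ^ 3 + (35/128) * y ^ 4 + (-63/256) * y ^ 5 + (231/1024) * y ^ 6 + (-429/2048) * y ^ 7 + (6435/32768) * y ^ 8 + (-12155/65536) * y ^ 9 + (1/2) * y ^ 10 := by
    have h1 := hb 1
    have h2 := hb 2
    have h3 := hb 3
    have h4 := hb 4
    have h5 := hb 5
    have h6 := hb 6
    have h7 := hb 7
    have h8 := hb 8
    have h9 := hb 9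
    have h10 := hb 10
    norm_num at h1 h2 h3 h4 h5 h6 h7 h8 h9 h10 ⊢
    linarith [h1.1, h1.2, h2.1, h2.2, h3.1, h3.2, h4.1, h4.2, h5.1, h5.2, h6.1, h6.2, h7.1, h7.2, h8.1, h8.2, h9.1, h9.2, h10.1, h10.2]

  have h0 := one_add_pos' y hy
  have hx := Real.sqrt_pos.2 h0
  have hx2 := Real.sq_sqrt h0.le
  rw [← one_div, div_le_iff₀ hx]
  refine le_of_abs_le (abs_le_of_sq_le_sq ?_ (mul_nonneg hp hx.le))
  rw [mul_pow, hx2]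
  linarith

lemma sqrt_hi (y : ℝ) (hy : |y| ≤ 34/100) : Real.sqrt (1 + y) ≤ (1) * y ^ 0 + (1/2) * y ^ 1 + (-1/8) * y ^ 2 + (1/16) * y ^ 3 + (-5/128) * y ^ 4 + (7/256) * y ^ 5 + (-21/1024) * y ^ 6 + (33/2048) * y ^ 7 + (-429/32768) * y ^ 8 + (715/65536) * y ^ 9 + (0) * y ^ 10 := by
  have h := Qa y hy
  have hb := pow_abs_bd y hy
  have hp : 0 ≤ (1) * y ^ 0 + (1/2) * y ^ 1 + (-1/8) * y ^ 2 + (1/16) * y ^ 3 + (-5/128) * y ^ 4 + (7/256) * y ^ 5 + (-21/1024) * y ^ 6 + (33/2048) * y ^ 7 + (-429/32768) * y ^ 8 + (715/65536) * y ^ 9 + (0) * y ^ 10 := by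
    have h1 := hb 1
    have h2 := hb 2
    have h3 := hb 3
    have h4 := hb 4
    have h5 := hb 5
    have h6 := hb 6
    have h7 := hb 7
    have h8 := hb 8
    have h9 := hb 9
    have h10 := hb 10
    norm_num at h1 h2 h3 h4 h5 h6 h7 h8 h9 h10 ⊢
    linarith [h1.1, h1.2, h2.1, h2.2, h3.1, h3.2, h4.1, h4.2, h5.1, h5.2, h6.1, h6.2, h7.1, h7.2, h8.1, h8.2, h9.1, h9.2, h10.1, h10.2]

  rw [Real.sqrt_le_left hp]
  linarith

lemma sqrt_lo (y : ℝ) (hy : |y| ≤ 34/100) : (1) * y ^ 0 + (1/2) * y ^ 1 + (-1/8) * y ^ 2 + (1/16) * y ^ 3 + (-5/128) * y ^ 4 + (7/256) * y ^ 5 + (-21/1024) * y ^ 6 + (33/2048) * y ^ 7 + (-429/32768) * y ^ 8 + (715/65536) * y ^ 9 + (-1/50) * y ^ 10 ≤ Real.sqrt (1 + y) := by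
  have h := Qb y hy
  apply Real.le_sqrt_of_sq_le
  linarith

lemma int_cos_two (f : ℝ → ℝ) :
    ∫ x in (0:ℝ)..(π/2), f (Real.cos (2 * x)) = (1/2) * ∫ x in (0:ℝ)..π, f (Real.cos x) := by
  have := intervalIntegral.integral_comp_mul_left (a := 0) (b := π/2)
    (fun x => f (Real.cos x)) (two_ne_zero (α := ℝ))
  rw [this]
  have h : 2 * (π/2) = π := by ring
  rw [h]; simp

lemma int_poly (q : ℝ) (c : ℕ → ℝ) :
    ∫ x in (0:ℝ)..(π/2), (c 0 * (q * Real.cos (2 * x)) ^ 0 + c 1 * (q * Real.cos (2 * x)) ^ 1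
      + c 2 * (q * Real.cos (2 * x)) ^ 2 + c 3 * (q * Real.cos (2 * x)) ^ 3
      + c 4 * (q * Real.cos (2 * x)) ^ 4 + c 5 * (q * Real.cos (2 * x)) ^ 5
      + c 6 * (q * Real.cos (2 * x)) ^ 6 + c 7 * (q * Real.cos (2 * x)) ^ 7
      + c 8 * (q * Real.cos (2 * x)) ^ 8 + c 9 * (q * Real.cos (2 * x)) ^ 9
      + c 10 * (q * Real.cos (2 * x)) ^ 10) =
    π / 2 * (c 0 + c 2 * q ^ 2 / 2 + c 4 * q ^ 4 * (3/8) + c 6 * q ^ 6 * (5/16)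
      + c 8 * q ^ 8 * (35/128) + c 10 * q ^ 10 * (63/256)) := by
  have h := int_cos_two (fun t => ∑ i ∈ Finset.range 11, c i * (q * t) ^ i)
  have h' : ∫ x in (0:ℝ)..π, ∑ i ∈ Finset.range 11, c i * (q * Real.cos x) ^ i =
      ∑ i ∈ Finset.range 11, c i * (q ^ i * ∫ x in (0:ℝ)..π, Real.cos x ^ i) := by
    rw [intervalIntegral.integral_finsetSum
      (fun i _ => Continuous.intervalIntegrable (by fun_prop) _ _)]
    simp only [mul_pow, intervalIntegral.integral_const_mul]
  rw [h'] at h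
  simp only [Finset.sum_range_succ, Finset.sum_range_zero, zero_add] at h
  rw [h]
  have h0 : ∫ x in (0:ℝ)..π, Real.cos x ^ 0 = π := by simp
  have h1 : ∫ x in (0:ℝ)..π, Real.cos x ^ 1 = 0 := by simp
  have hr : ∀ n : ℕ, ∫ x in (0:ℝ)..π, Real.cos x ^ (n + 2) =
      ((n:ℝ) + 1) / (n + 2) * ∫ x in (0:ℝ)..π, Real.cos x ^ n := by
    intro n; rw [integral_cos_pow]; simp
  have h2 := hr 0
  have h3 := hr 1
  have h4 := hr 2
  have h5 := hr 3
  have h6 := hr 4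
  have h7 := hr 5
  have h8 := hr 6
  have h9 := hr 7
  have h10 := hr 8
  simp only [Nat.reduceAdd, zero_add] at h2 h3 h4 h5 h6 h7 h8 h9 h10
  rw [h10, h9, h8, h7, h6, h5, h4, h3, h2, h1, h0]
  push_cast
  ring

lemma dn_form (x : ℝ) : Real.sqrt (1 - (0.71:ℝ) ^ 2 * Real.sin x ^ 2) =
    Real.sqrt (14959/20000) * Real.sqrt (1 + 5041/14959 * Real.cos (2 * x)) := by
  rw [← Real.sqrt_mul (by norm_num), Real.cos_two_mul, Real.sin_sq]
  congr 1
  ring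

lemma y_bd (x : ℝ) : |5041/14959 * Real.cos (2 * x)| ≤ 34/100 := by
  rw [abs_mul, abs_of_pos (by norm_num)]
  have := Real.abs_cos_le_one (2 * x)
  linarith

lemma sq_cont : Continuous fun x : ℝ => Real.sqrt (1 + 5041/14959 * Real.cos (2 * x)) := by
  fun_prop

lemma sq_inv_cont : Continuous fun x : ℝ =>
    (Real.sqrt (1 + 5041/14959 * Real.cos (2 * x)))⁻¹ :=
  sq_cont.inv₀ fun x => (Real.sqrt_pos.2 (one_add_pos' _ (y_bd x))).ne'

lemma rc_lo : (0.8648410:ℝ) ≤ Real.sqrt (14959/20000) :=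
  Real.le_sqrt_of_sq_le (by norm_num)
lemma rc_hi : Real.sqrt (14959/20000) ≤ (0.8648411:ℝ) := by
  rw [Real.sqrt_le_left (by norm_num)]; norm_num

lemma JK_lo : π / 2 * 1.02272716 ≤ ∫ x in (0:ℝ)..(π/2), (Real.sqrt (1 + 5041/14959 * Real.cos (2 * x)))⁻¹ := by
  have h := intervalIntegral.integral_mono_on (a := 0) (b := π/2) (μ := volume) (by positivity)
    (Continuous.intervalIntegrable (by fun_prop) _ _)
    (Continuous.intervalIntegrable (sq_inv_cont) _ _)
    (fun x _ => inv_sqrt_lo _ (y_bd x))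
  have e := int_poly (5041/14959) (fun i => ([(1), (-1/2), (3/8), (-5/16), (35/128), (-63/256), (231/1024), (-429/2048), (6435/32768), (-12155/65536), (0)] : List ℝ).getD i 0)
  simp only [List.getD_cons_zero, List.getD_cons_succ] at e
  rw [e] at h
  refine le_trans ?_ h
  apply mul_le_mul_of_nonneg_left _ (by positivity)
  norm_num

lemma JK_hi : ∫ x in (0:ℝ)..(π/2), (Real.sqrt (1 + 5041/14959 * Real.cos (2 * x)))⁻¹ ≤ π / 2 * 1.02272949 := by
  have h := intervalIntegral.integral_mono_on (a := 0) (b := π/2) (μ := volume) (by positivity)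
    (Continuous.intervalIntegrable (sq_inv_cont) _ _)
    (Continuous.intervalIntegrable (by fun_prop) _ _)
    (fun x _ => inv_sqrt_hi _ (y_bd x))
  have e := int_poly (5041/14959) (fun i => ([(1), (-1/2), (3/8), (-5/16), (35/128), (-63/256), (231/1024), (-429/2048), (6435/32768), (-12155/65536), (1/2)] : List ℝ).getD i 0)
  simp only [List.getD_cons_zero, List.getD_cons_succ] at e
  rw [e] at h
  refine h.trans ?_
  apply mul_le_mul_of_nonneg_left _ (by positivity)
  norm_num

lemma JE_lo : π / 2 * 0.99270347 ≤ ∫ x in (0:ℝ)..(π/2), Real.sqrt (1 + 5041/14959 * Real.cos (2 * x)) := by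
  have h := intervalIntegral.integral_mono_on (a := 0) (b := π/2) (μ := volume) (by positivity)
    (Continuous.intervalIntegrable (by fun_prop) _ _)
    (Continuous.intervalIntegrable (sq_cont) _ _)
    (fun x _ => sqrt_lo _ (y_bd x))
  have e := int_poly (5041/14959) (fun i => ([(1), (1/2), (-1/8), (1/16), (-5/128), (7/256), (-21/1024), (33/2048), (-429/32768), (715/65536), (-1/50)] : List ℝ).getD i 0)
  simp only [List.getD_cons_zero, List.getD_cons_succ] at e
  rw [e] at h
  refine le_trans ?_ h
  apply mul_le_mul_of_nonneg_left _ (by positivity)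
  norm_num

lemma JE_hi : ∫ x in (0:ℝ)..(π/2), Real.sqrt (1 + 5041/14959 * Real.cos (2 * x)) ≤ π / 2 * 0.99270357 := by
  have h := intervalIntegral.integral_mono_on (a := 0) (b := π/2) (μ := volume) (by positivity)
    (Continuous.intervalIntegrable (sq_cont) _ _)
    (Continuous.intervalIntegrable (by fun_prop) _ _)
    (fun x _ => sqrt_hi _ (y_bd x))
  have e := int_poly (5041/14959) (fun i => ([(1), (1/2), (-1/8), (1/16), (-5/128), (7/256), (-21/1024), (33/2048), (-429/32768), (715/65536), (0)] : List ℝ).getD i 0)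
  simp only [List.getD_cons_zero, List.getD_cons_succ] at e
  rw [e] at h
  refine h.trans ?_
  apply mul_le_mul_of_nonneg_left _ (by positivity)
  norm_num

lemma K_eq : ellK 0.71 = (Real.sqrt (14959/20000))⁻¹ *
    ∫ x in (0:ℝ)..(π/2), (Real.sqrt (1 + 5041/14959 * Real.cos (2 * x)))⁻¹ := by
  unfold ellK ellF
  simp only [dn_form, mul_inv, intervalIntegral.integral_const_mul]

lemma E_eq : ellE 0.71 = Real.sqrt (14959/20000) *
    ∫ x in (0:ℝ)..(π/2), Real.sqrt (1 + 5041/14959 * Real.cos (2 * x)) := by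
  unfold ellE
  simp only [dn_form, intervalIntegral.integral_const_mul]

lemma K_lo : 1.857561 ≤ ellK 0.71 := by
  rw [K_eq, inv_mul_eq_div, le_div_iff₀ (by linarith [rc_lo])]
  linarith [JK_lo, rc_hi, Real.pi_gt_d6]

lemma K_hi : ellK 0.71 ≤ 1.857568 := by
  rw [K_eq, inv_mul_eq_div, div_le_iff₀ (by linarith [rc_lo])]
  linarith [JK_hi, rc_lo, Real.pi_lt_d6]

lemma E_lo : 1.348576 ≤ ellE 0.71 := by
  rw [E_eq]
  have h1 : (1.5593345:ℝ) ≤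
    ∫ x in (0:ℝ)..(π/2), Real.sqrt (1 + 5041/14959 * Real.cos (2 * x)) := by
    linarith [JE_lo, Real.pi_gt_d6]
  have := mul_le_mul rc_lo h1 (by norm_num) (Real.sqrt_nonneg _)
  linarith

lemma E_hi : ellE 0.71 ≤ 1.348578 := by
  rw [E_eq]
  have h1 : ∫ x in (0:ℝ)..(π/2), Real.sqrt (1 + 5041/14959 * Real.cos (2 * x)) ≤ 1.559336 := by
    linarith [JE_hi, Real.pi_lt_d6]
  have h2 : (0:ℝ) ≤ ∫ x in (0:ℝ)..(π/2), Real.sqrt (1 + 5041/14959 * Real.cos (2 * x)) := by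
    linarith [JE_lo, Real.pi_gt_d6]
  have := mul_le_mul rc_hi h1 h2 (by norm_num)
  linarith


lemma final_num (K E X Y Z A : ℝ) (hK1 : 1.857561 ≤ K) (hK2 : K ≤ 1.857568)
    (hE1 : 1.348576 ≤ E) (hE2 : E ≤ 1.348578)
    (e2 : (1 - 0.5041) * (2 * K) + 0.5041 * X = 2 * E)
    (e4 : 3 * 0.5041 * Y + (2 - 4 * 0.5041) * X - (1 - 0.5041) * (2 * K) = 0)
    (e6 : 5 * 0.5041 * Z + (4 - 8 * 0.5041) * Y - 3 * (1 - 0.5041) * X = 0)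
    (hX : 1.6957 ≤ X) (hA : A = Real.pi / (K * (X / 2))) :
    0 < A * X * (-(A * ((1 - 0.5041) * (2 * K) + (2 * 0.5041 - 1) * X - 0.5041 * Y))
      + 1 / 2 * (A ^ 2 * Y)) -
      2 * (2 * K) * (A * ((2 * 0.5041 - 1) ^ 2 * X + 2 * (2 * 0.5041 - 1) *
        (A / 2 - 2 * 0.5041) * Y + (A / 2 - 2 * 0.5041) ^ 2 * Z)) ∧
    2 * K * (A * X) = 4 * Real.pi := by
  have hX0 : 0 < X := by linarith
  have hK0 : 0 < K := by linarith
  have hAX : K * A * X = 2 * π := by rw [hA]; field_simp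
  refine ⟨?_, by linarith⟩
  have hX1 : 1.695722 ≤ X := by linarith
  have hX2 : X ≤ 1.695754 := by linarith
  have hY1 : 1.23661 ≤ Y := by linarith
  have hY2 : Y ≤ 1.23663 := by linarith
  have hZ1 : 1.01697 ≤ Z := by linarith
  have hZ2 : Z ≤ 1.01700 := by linarith
  have hD : (1 - 0.5041) * (2 * K) + (2 * 0.5041 - 1) * X - 0.5041 * Y ≤ 1.23286 := by linarith
  have hKX1 := mul_le_mul hK1 hX1 (by norm_num) hK0.le
  have hKX2 := mul_le_mul hK2 hX2 hX0.le (by norm_num)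
  have hA0 : 0 < A := by rw [hA]; positivity
  have hA1 : 1.99467 ≤ A := by
    rw [hA, le_div_iff₀ (by positivity)]; linarith [Real.pi_gt_d6]
  have hA2 : A ≤ 1.99473 := by
    rw [hA, div_le_iff₀ (by positivity)]; linarith [Real.pi_lt_d6]
  have hb1 : -0.01087 ≤ A / 2 - 2 * 0.5041 := by linarith
  have hb2 : A / 2 - 2 * 0.5041 ≤ -0.010835 := by linarith
  generalize (1 - 0.5041) * (2 * K) + (2 * 0.5041 - 1) * X - 0.5041 * Y = D at *
  generalize A / 2 - 2 * 0.5041 = b at *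
  have h1 := mul_le_mul hA1 hY1 (by norm_num) hA0.le
  have h2 : 0.00045 ≤ -D + A * Y / 2 := by linarith
  have h3 := mul_le_mul hA1 hX1 (by norm_num) hA0.le
  have h4 : 0.0015 ≤ (A * X) * (-D + A * Y / 2) := by
    have := mul_le_mul h3 h2 (by norm_num) (by positivity)
    linarith
  have h5 : 0.010835 * 1.23661 ≤ (-b) * Y :=
    mul_le_mul (by linarith) hY1 (by norm_num) (by linarith)
  have h6 : (-b) * (-b) ≤ 0.01087 * 0.01087 :=
    mul_le_mul (by linarith) (by linarith) (by linarith) (by norm_num)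
  have h7 : ((-b) * (-b)) * Z ≤ (0.01087 * 0.01087) * 1.01700 :=
    mul_le_mul h6 hZ2 (by linarith) (by norm_num)
  have h8 : (2 * 0.5041 - 1) ^ 2 * X + 2 * (2 * 0.5041 - 1) * b * Y + b ^ 2 * Z ≤ 0.00002 := by
    have e : b ^ 2 * Z = ((-b) * (-b)) * Z := by ring
    rw [e]
    linarith
  have h9 : K * ((2 * 0.5041 - 1) ^ 2 * X + 2 * (2 * 0.5041 - 1) * b * Y + b ^ 2 * Z)
      ≤ K * 0.00002 := mul_le_mul_of_nonneg_left h8 hK0.le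
  have h10 : 0 < (A * X) * (-D + A * Y / 2) -
      4 * (K * ((2 * 0.5041 - 1) ^ 2 * X + 2 * (2 * 0.5041 - 1) * b * Y + b ^ 2 * Z)) := by
    linarith
  have := mul_pos hA0 h10
  refine this.trans_eq ?_
  ring

/-- Remark 4: with `k = 0.71` and `a² = π/(K² − (1/k²)(K² − E·K))`, the function
`u(s) = a·cn(s,k)` on `[0, 2K(k)]` makes the quantity `LHS` strictly positive while
`L·∫u² = 4π`, disproving the conjectured refined inequality. -/
theorem refined_inequality_counterexample :
    let k : ℝ := 0.71
    let a : ℝ := Real.sqrt (Real.pi /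
      ((ellK k) ^ 2 - (1 / k ^ 2) * ((ellK k) ^ 2 - ellE k * ellK k)))
    let u : ℝ → ℝ := fun s => a * cn k s
    let L : ℝ := 2 * ellK k
    0 < (∫ s in (0:ℝ)..L, (u s) ^ 2) *
          (-(∫ s in (0:ℝ)..L, (deriv u s) ^ 2) + (1/2) * ∫ s in (0:ℝ)..L, (u s) ^ 4)
        - 2 * L * ∫ s in (0:ℝ)..L, (deriv (deriv u) s + (1/2) * (u s) ^ 3) ^ 2
    ∧ L * ∫ s in (0:ℝ)..L, (u s) ^ 2 = 4 * Real.pi := by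
  intro k a u L
  have hk : k ^ 2 < 1 := by norm_num [k]
  have hm : k ^ 2 = 0.5041 := by norm_num [k]
  have e2 := I2 hk
  have e4 := I4 hk
  have e6 := I6 hk
  have d1 := int_du hk a
  have d2 := int_d2u hk a
  have u2 := int_u2 (k := k) a
  have u4 := int_u4 (k := k) a
  have hK1 : 1.857561 ≤ ellK k := K_lo
  have hK2 : ellK k ≤ 1.857568 := K_hi
  have hE1 : 1.348576 ≤ ellE k := E_lo
  have hE2 : ellE k ≤ 1.348578 := E_hi
  clear_value k
  change 0 < (∫ s in (0:ℝ)..(2 * ellK k), (a * cn k s) ^ 2) *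
          (-(∫ s in (0:ℝ)..(2 * ellK k), (deriv (fun s => a * cn k s) s) ^ 2)
            + (1/2) * ∫ s in (0:ℝ)..(2 * ellK k), (a * cn k s) ^ 4)
        - 2 * (2 * ellK k) * ∫ s in (0:ℝ)..(2 * ellK k),
          (deriv (deriv (fun s => a * cn k s)) s + (1/2) * (a * cn k s) ^ 3) ^ 2
    ∧ (2 * ellK k) * ∫ s in (0:ℝ)..(2 * ellK k), (a * cn k s) ^ 2 = 4 * Real.pi
  have hden : (ellK k) ^ 2 - (1 / k ^ 2) * ((ellK k) ^ 2 - ellE k * ellK k) =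
      ellK k * ((∫ s in (0:ℝ)..(2 * ellK k), cn k s ^ 2) / 2) := by
    rw [hm] at e2 ⊢
    have : (∫ s in (0:ℝ)..(2 * ellK k), cn k s ^ 2) =
      (2 * ellE k - (1 - 0.5041) * (2 * ellK k)) / 0.5041 := by
      rw [eq_div_iff (by norm_num)]; linarith
    rw [this]; ring
  have hI2 : 1.6957 ≤ ∫ s in (0:ℝ)..(2 * ellK k), cn k s ^ 2 := by
    rw [hm] at e2; linarith
  have hapos : 0 ≤ Real.pi /
      ((ellK k) ^ 2 - (1 / k ^ 2) * ((ellK k) ^ 2 - ellE k * ellK k)) := by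
    rw [hden]
    have := Real.pi_pos
    apply div_nonneg this.le
    exact mul_nonneg (le_trans (by norm_num) hK1) (div_nonneg (le_trans (by norm_num) hI2) (by norm_num))
  have ha2 : a ^ 2 = Real.pi /
      (ellK k * ((∫ s in (0:ℝ)..(2 * ellK k), cn k s ^ 2) / 2)) := by
    rw [← hden]
    exact Real.sq_sqrt hapos
  rw [d1, d2, u2, u4, show a ^ 4 = (a ^ 2) ^ 2 by ring]
  rw [hm] at *
  clear d1 d2 u2 u4 hden hapos hk hm
  generalize a ^ 2 = A at *
  clear_value a u L
  generalize (∫ s in (0:ℝ)..(2 * ellK k), cn k s ^ 2) = X at *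
  generalize (∫ s in (0:ℝ)..(2 * ellK k), cn k s ^ 4) = Y at *
  generalize (∫ s in (0:ℝ)..(2 * ellK k), cn k s ^ 6) = Z at *
  generalize ellK k = K at *
  generalize ellE k = E at *
  exact final_num K E X Y Z A hK1 hK2 hE1 hE2 e2 e4 e6 hI2 ha2
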